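/- Let n ≥ 2, r ∈ End(ℝ^n), β ∈ Λ^{n−2}(ℝ^n), b ∈ Λ^{n−2}(ℝ^n)*, and define the operator R : W → W by R(η, η̃) := ( (tr r / 2)·η + ρ(r)η + ι_βη̃ , (tr r / 2)·η̃ + ρ(r)η̃ + η ∧ s(b) ). Then R is B-skew: B(RY, Y') + B(Y, RY') = 0 for all Y, Y' ∈ W. (This is the statement in the paper that setting the scaling parameter l = (1/2) r^a{}_a in the adjoint action on X picks out the so(n,n) subalgebra of so(n,n) ⊕ ℝ.) -/

import Mathlib

open scoped BigOperators

noncomputable section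

/-- `ℝ^n` -/
abbrev Vn (n : ℕ) : Type := Fin n → ℝ

/-- alternating `k`-forms on `ℝ^n`, i.e. `Λ^k (ℝ^n)^*` (also used as a model of the space
`Λ^k ℝ^n` of `k`-vectors, a `k`-vector being recorded through its components
`β^{i_1…i_k} = β(e_{i_1},…,e_{i_k})` with respect to the standard basis). -/
abbrev Form (n k : ℕ) : Type := (Vn n) [⋀^Fin k]→ₗ[ℝ] ℝ

/-- the standard basis vector `e_m` of `ℝ^n` -/
def ee {n : ℕ} (m : Fin n) : Vn n := Pi.single m 1

/-- the determinant (volume) form `vol = dy^1 ∧ ⋯ ∧ dy^n` -/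
def vol (n : ℕ) : Form n n := (Pi.basisFun ℝ (Fin n)).det

/-- regard a covector as a `1`-form -/
def oneForm {n : ℕ} (α : Module.Dual ℝ (Vn n)) : Form n 1 :=
  AlternatingMap.ofSubsingleton ℝ (Vn n) ℝ (0 : Fin 1) α

/-- the dual basis covector `dy^m`, as a `1`-form -/
def dy {n : ℕ} (m : Fin n) : Form n 1 := oneForm (LinearMap.proj m)

/-- re-index a form along an equality of degrees -/
def Form.castDeg {n a b : ℕ} (h : a = b) (ω : Form n a) : Form n b :=
  ω.domDomCongr (finCongr h)

/-- the wedge product of alternating forms (shuffle convention, so that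
`dy^1 ∧ ⋯ ∧ dy^n = vol` and `(α ∧ ω)(v_0,…,v_k) = ∑_i (-1)^i α(v_i) ω(v_0,…,v̂_i,…,v_k)`
for a `1`-form `α`) -/
def wedge {n a b : ℕ} (ω : Form n a) (τ : Form n b) : Form n (a + b) :=
  ((TensorProduct.lid ℝ ℝ).toLinearMap.compAlternatingMap (ω.domCoprod τ)).domDomCongr
    finSumFinEquiv

/-- the interior product `ι_{e_m} ω = ω(e_m, ·, …, ·)`; `ι_{e_m} vol` is the flat-space
Hodge dual `⋆ dy^m` -/
def iotaE {n k : ℕ} (m : Fin n) (ω : Form n (k + 1)) : Form n k := ω.curryLeft (ee m)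

/-- `W := (ℝ^n)^* ⊕ Λ^{n-1}(ℝ^n)^*`, for `n = N + 1` -/
abbrev Wsp (N : ℕ) : Type := Form (N + 1) 1 × Form (N + 1) N

/-- the `Λ^n(ℝ^n)^*`-valued symmetric pairing `B((η,η̃),(η',η̃')) := η ∧ η̃' + η' ∧ η̃`
(the `Spin(n,n)`-invariant inner product on the bundle `X`). -/
def Bf {N : ℕ} (Y Y' : Wsp N) : Form (N + 1) (N + 1) :=
  Form.castDeg (Nat.add_comm 1 N) (wedge Y.1 Y'.2 + wedge Y'.1 Y.2)

/-- contraction of a list of `k` vectors into the first `k` arguments of a `(q+k)`-form -/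
def mcontract {n : ℕ} : {k q : ℕ} → (Fin k → Vn n) → Form n (q + k) → Form n q
  | 0, _, _, ω => ω
  | (k + 1), q, u, ω => mcontract (k := k) (q := q) (fun j => u j.succ) (ω.curryLeft (u 0))

/-- interior product `ι_β ω` of a `k`-vector `β` (given through its components
`β^{i_1…i_k} = β(e_{i_1},…,e_{i_k})`) into the first `k` arguments of a `(q+k)`-form `ω`:
`(ι_β ω) = (1/k!) ∑ β^{i_1…i_k} ω(e_{i_1},…,e_{i_k},·,…,·)`. -/
def contract {n k q : ℕ} (β : Form n k) (ω : Form n (q + k)) : Form n q :=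
  ((Nat.factorial k : ℕ) : ℝ)⁻¹ • ∑ I : Fin k → Fin n,
    β (fun j => ee (I j)) • mcontract (fun j => ee (I j)) ω

/-- `s(λ) := (-1)^{⌊p/2⌋} λ` on `p`-forms -/
def sform {n k : ℕ} (ω : Form n k) : Form n k := ((-1 : ℝ) ^ (k / 2)) • ω

/-- the derivation action `ρ(r)` of `r ∈ End(ℝ^n)` on forms, extending `α ↦ -α∘r`
on covectors; concretely `ρ(r)ω = -∑_{a,b} r^a{}_b · dy^b ∧ ι_{e_a}ω`. -/
def rho {n : ℕ} (r : Module.End ℝ (Vn n)) : {k : ℕ} → Form n k → Form n k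
  | 0, _ => 0
  | (s + 1), ω =>
      -∑ a : Fin n, ∑ b : Fin n,
        r (ee b) a • Form.castDeg (Nat.add_comm 1 s) (wedge (dy b) (ω.curryLeft (ee a)))

/-- the derivation action `ρ̂(r)` of `r ∈ End(ℝ^n)` on multivectors (represented through
their components as alternating maps), extending `v ↦ r v` on vectors;
concretely `ρ̂(r)β = ∑_{a,b} r^b{}_a · dy^b ∧ ι_{e_a}β` in the components model. -/
def rhoHat {n : ℕ} (r : Module.End ℝ (Vn n)) : {k : ℕ} → Form n k → Form n k
  | 0, _ => 0
  | (s + 1), β =>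
      ∑ a : Fin n, ∑ b : Fin n,
        r (ee a) b • Form.castDeg (Nat.add_comm 1 s) (wedge (dy b) (β.curryLeft (ee a)))

/-- the full contraction `⟨β, b⟩ = (1/k!) β^{i_1…i_k} b_{i_1…i_k}` -/
def fullContract {n k : ℕ} (β b : Form n k) : ℝ :=
  ((Nat.factorial k : ℕ) : ℝ)⁻¹ * ∑ I : Fin k → Fin n,
    β (fun j => ee (I j)) * b (fun j => ee (I j))

/-- the single-index partial contraction `C(β,b)^a{}_c = (1/m!) β^{a j_1…j_m} b_{c j_1…j_m}`
of a degree-`(m+1)` multivector `β` and form `b`, as an endomorphism of `ℝ^n`. -/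
def Cmat {n m : ℕ} (β b : Form n (m + 1)) : Module.End ℝ (Vn n) :=
  Matrix.toLin' (Matrix.of fun a c : Fin n =>
    ((Nat.factorial m : ℕ) : ℝ)⁻¹ * ∑ J : Fin m → Fin n,
      β (Fin.cons (ee a) fun j => ee (J j)) * b (Fin.cons (ee c) fun j => ee (J j)))

/-- the inner product on `k`-forms induced by the standard inner product of `ℝ^n`
(the `dy^{i_1} ∧ ⋯ ∧ dy^{i_k}`, `i_1 < ⋯ < i_k`, are orthonormal; equivalently on
`(n-1)`-forms it is the inner product making `ι_{e_1}vol, …, ι_{e_n}vol` orthonormal). -/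
def ipk {n k : ℕ} (ω ω' : Form n k) : ℝ :=
  ((Nat.factorial k : ℕ) : ℝ)⁻¹ * ∑ I : Fin k → Fin n,
    ω (fun j => ee (I j)) * ω' (fun j => ee (I j))

/-- the adjoint-type operator
`R(η, η̃) := ((tr r/2)·η + ρ(r)η + ι_β η̃, (tr r/2)·η̃ + ρ(r)η̃ + η ∧ s(b))` on
`W = (ℝ^n)^* ⊕ Λ^{n-1}(ℝ^n)^*`, for `n = m + 2`, with `r ∈ End(ℝ^n)`,
`β ∈ Λ^{n-2}ℝ^n` (in the components model) and `b ∈ Λ^{n-2}(ℝ^n)^*`. -/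
def Rop {m : ℕ} (r : Module.End ℝ (Vn (m + 2))) (β : Form (m + 2) m) (b : Form (m + 2) m)
    (Y : Wsp (m + 1)) : Wsp (m + 1) :=
  ((LinearMap.trace ℝ (Vn (m + 2)) r / 2) • Y.1 + rho r Y.1 +
      contract β (Form.castDeg (Nat.add_comm m 1) Y.2),
    (LinearMap.trace ℝ (Vn (m + 2)) r / 2) • Y.2 + rho r Y.2 +
      Form.castDeg (Nat.add_comm 1 m) (wedge Y.1 (sform b)))

section WedgeOneForm

variable {n k : ℕ}

/-- The identification `Fin 1 ⊕ Fin k ≃ Fin (k + 1)` sending the left summand to `0`. -/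
def sumFinOneEquiv (k : ℕ) : Fin 1 ⊕ Fin k ≃ Fin (k + 1) :=
  finSumFinEquiv.trans (finCongr (Nat.add_comm 1 k))

@[simp]
lemma sumFinOneEquiv_inl (i : Fin 1) : sumFinOneEquiv k (Sum.inl i) = 0 := by
  ext
  simp [sumFinOneEquiv]

@[simp]
lemma sumFinOneEquiv_inr (j : Fin k) : sumFinOneEquiv k (Sum.inr j) = j.succ := by
  ext
  simp [sumFinOneEquiv]

@[simp]
lemma sumFinOneEquiv_symm_zero : (sumFinOneEquiv k).symm 0 = Sum.inl 0 := by
  rw [Equiv.symm_apply_eq, sumFinOneEquiv_inl]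

/-- The `(1, k)`-shuffle moving `i` to the front. -/
def oneShuffle (i : Fin (k + 1)) : Equiv.Perm (Fin 1 ⊕ Fin k) :=
  (sumFinOneEquiv k).symm.permCongr i.cycleRange.symm

lemma sumFinOneEquiv_oneShuffle_inl (i : Fin (k + 1)) (j : Fin 1) :
    sumFinOneEquiv k (oneShuffle i (Sum.inl j)) = i := by
  simp [oneShuffle, Equiv.permCongr_apply]

lemma sumFinOneEquiv_oneShuffle_inr (i : Fin (k + 1)) (j : Fin k) :
    sumFinOneEquiv k (oneShuffle i (Sum.inr j)) = i.succAbove j := by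
  simp [oneShuffle, Equiv.permCongr_apply]

lemma sign_oneShuffle (i : Fin (k + 1)) : (oneShuffle i).sign = (-1) ^ (i : ℕ) := by
  simp [oneShuffle, Equiv.Perm.sign_permCongr]

/-- The shuffles `oneShuffle i` represent the cosets indexing `AlternatingMap.domCoprod`. -/
lemma bijective_mk_oneShuffle : Function.Bijective
    (fun i : Fin (k + 1) =>
      (Quotient.mk'' (oneShuffle i) : Equiv.Perm.ModSumCongr (Fin 1) (Fin k))) := by
  constructor
  · intro i j hij
    obtain ⟨⟨sl, sr⟩, hs⟩ := QuotientGroup.leftRel_apply.mp (Quotient.exact' hij)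
    have h0 := Equiv.congr_fun hs (Sum.inl 0)
    simp only [Equiv.Perm.sumCongrHom_apply, Equiv.Perm.sumCongr_apply, Sum.map_inl,
      Equiv.Perm.mul_apply, Equiv.Perm.eq_inv_iff_eq] at h0
    rw [← sumFinOneEquiv_oneShuffle_inl i (sl 0), h0, sumFinOneEquiv_oneShuffle_inl]
  · intro q
    induction q using Quotient.inductionOn' with | _ σ
    refine ⟨sumFinOneEquiv k (σ (Sum.inl 0)), Quotient.sound' ?_⟩
    rw [QuotientGroup.leftRel_apply]
    apply Equiv.Perm.mem_sumCongrHom_range_of_perm_mapsTo_inl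
    rintro _ ⟨i, rfl⟩
    refine ⟨0, ?_⟩
    rw [Equiv.Perm.mul_apply, Equiv.Perm.eq_inv_iff_eq, Subsingleton.elim i 0]
    exact (sumFinOneEquiv k).injective (sumFinOneEquiv_oneShuffle_inl _ _)

open scoped TensorProduct in
theorem castDeg_wedge_apply (α : Form n 1) (ω : Form n k) (v : Fin (k + 1) → Vn n) :
    Form.castDeg (Nat.add_comm 1 k) (wedge α ω) v =
      ∑ i : Fin (k + 1), (-1) ^ (i : ℕ) * (α (fun _ => v i) * ω (i.removeNth v)) := by
  have h : Form.castDeg (Nat.add_comm 1 k) (wedge α ω) v =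
      TensorProduct.lid ℝ ℝ (α.domCoprod ω (v ∘ sumFinOneEquiv k)) := rfl
  rw [h, AlternatingMap.domCoprod_apply, sum_apply, map_sum]
  refine (Fintype.sum_bijective _ bijective_mk_oneShuffle _ _ fun i => ?_).symm
  rw [AlternatingMap.domCoprod.summand_mk'', sign_oneShuffle]
  have hα : (fun j => v (sumFinOneEquiv k (oneShuffle i (Sum.inl j)))) = fun _ => v i := by
    simp only [sumFinOneEquiv_oneShuffle_inl]
  have hω : (fun j => v (sumFinOneEquiv k (oneShuffle i (Sum.inr j)))) = i.removeNth v := by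
    simp only [sumFinOneEquiv_oneShuffle_inr]
    rfl
  rw [← hα, ← hω]
  change _ = TensorProduct.lid ℝ ℝ (((-1 : ℤˣ) ^ (i : ℕ)) •
    (α (fun j => v (sumFinOneEquiv k (oneShuffle i (Sum.inl j)))) ⊗ₜ[ℝ]
      ω (fun j => v (sumFinOneEquiv k (oneShuffle i (Sum.inr j))))))
  rcases Nat.even_or_odd (i : ℕ) with hi | hi <;> simp [hi.neg_one_pow]

/-- The wedge product `α ∧ ω` with a `1`-form on the left, as a bilinear map. -/
def wedgeOne : Form n 1 →ₗ[ℝ] Form n k →ₗ[ℝ] Form n (k + 1) :=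
  LinearMap.mk₂ ℝ (fun α ω => Form.castDeg (Nat.add_comm 1 k) (wedge α ω))
    (fun α α' ω => by
      ext v
      simp only [castDeg_wedge_apply, AlternatingMap.add_apply, ← Finset.sum_add_distrib]
      exact Finset.sum_congr rfl fun i _ => by ring)
    (fun c α ω => by
      ext v
      simp only [castDeg_wedge_apply, AlternatingMap.smul_apply, smul_eq_mul, Finset.mul_sum]
      exact Finset.sum_congr rfl fun i _ => by ring)
    (fun α ω ω' => by
      ext v
      simp only [castDeg_wedge_apply, AlternatingMap.add_apply, ← Finset.sum_add_distrib]
      exact Finset.sum_congr rfl fun i _ => by ring)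
    (fun c α ω => by
      ext v
      simp only [castDeg_wedge_apply, AlternatingMap.smul_apply, smul_eq_mul, Finset.mul_sum]
      exact Finset.sum_congr rfl fun i _ => by ring)

lemma castDeg_wedge (α : Form n 1) (ω : Form n k) :
    Form.castDeg (Nat.add_comm 1 k) (wedge α ω) = wedgeOne α ω := rfl

lemma wedgeOne_apply (α : Form n 1) (ω : Form n k) (v : Fin (k + 1) → Vn n) :
    wedgeOne α ω v =
      ∑ i : Fin (k + 1), (-1) ^ (i : ℕ) * (α (fun _ => v i) * ω (i.removeNth v)) :=
  castDeg_wedge_apply α ω v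

lemma curryLeft_wedgeOne_zero (α : Form n 1) (ω : Form n 0) (x : Vn n) :
    (wedgeOne α ω).curryLeft x = α (fun _ => x) • ω := by
  ext w
  have hw : (0 : Fin 1).removeNth (Matrix.vecCons x w) = w := Subsingleton.elim _ _
  simp [wedgeOne_apply, hw]

/-- Interior product by a vector is an antiderivation. -/
lemma curryLeft_wedgeOne (α : Form n 1) (ω : Form n (k + 1)) (x : Vn n) :
    (wedgeOne α ω).curryLeft x = α (fun _ => x) • ω - wedgeOne α (ω.curryLeft x) := by
  ext w
  simp only [AlternatingMap.curryLeft_apply_apply, AlternatingMap.sub_apply,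
    AlternatingMap.smul_apply, wedgeOne_apply, Matrix.vecCons]
  rw [Fin.sum_univ_succ, sub_eq_add_neg, ← Finset.sum_neg_distrib]
  congr 1
  · simp [Fin.removeNth_zero]
  · refine Finset.sum_congr rfl fun i _ => ?_
    have : i.succ.removeNth (Fin.cons x w : Fin (k + 2) → Vn n) = Fin.cons x (i.removeNth w) := by
      ext j : 1
      refine Fin.cases ?_ (fun j => ?_) j <;> simp [Fin.removeNth]
    rw [this, Fin.cons_succ, Fin.val_succ, pow_succ]
    ring

lemma form_ext_curryLeft {ω ω' : Form n (k + 1)} (h : ∀ x, ω.curryLeft x = ω'.curryLeft x) :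
    ω = ω' := by
  ext v
  have := congrArg (fun τ : Form n k => τ (Fin.tail v)) (h (v 0))
  simpa [Matrix.vecCons] using this

/-- `1`-forms anticommute. -/
lemma wedgeOne_anticomm (α α' : Form n 1) (ω : Form n k) :
    wedgeOne α (wedgeOne α' ω) = -wedgeOne α' (wedgeOne α ω) := by
  induction k with
  | zero =>
    refine form_ext_curryLeft fun x => ?_
    have hneg : (-wedgeOne α' (wedgeOne α ω)).curryLeft x =
        -(wedgeOne α' (wedgeOne α ω)).curryLeft x := rfl
    rw [hneg, curryLeft_wedgeOne, curryLeft_wedgeOne, curryLeft_wedgeOne_zero,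
      curryLeft_wedgeOne_zero, map_smul, map_smul]
    abel
  | succ k ih =>
    refine form_ext_curryLeft fun x => ?_
    have hneg : (-wedgeOne α' (wedgeOne α ω)).curryLeft x =
        -(wedgeOne α' (wedgeOne α ω)).curryLeft x := rfl
    rw [hneg, curryLeft_wedgeOne, curryLeft_wedgeOne, curryLeft_wedgeOne, curryLeft_wedgeOne,
      map_sub, map_sub, map_smul, map_smul, ih]
    abel

/-- Forms of degree exceeding the dimension vanish. -/
lemma form_eq_zero_of_lt (h : n < k) (ω : Form n k) : ω = 0 :=
  Module.Basis.ext_alternating (Pi.basisFun ℝ (Fin n)) fun v hv =>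
    absurd (Fintype.card_le_of_injective v hv) (by simpa using h)

/-- For a top-degree form `Ω`, `α ∧ ι_x Ω = α(x) Ω`. -/
lemma wedgeOne_curryLeft (α : Form (k + 1) 1) (Ω : Form (k + 1) (k + 1)) (x : Vn (k + 1)) :
    wedgeOne α (Ω.curryLeft x) = α (fun _ => x) • Ω := by
  have h := curryLeft_wedgeOne α Ω x
  rw [form_eq_zero_of_lt (Nat.lt_succ_self _) (wedgeOne α Ω), AlternatingMap.curryLeft_zero] at h
  exact (sub_eq_zero.mp h.symm).symm

lemma dy_apply (a : Fin n) (v : Fin 1 → Vn n) : dy a v = v 0 a := rfl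

@[simp]
lemma ee_apply_self (a : Fin n) : ee a a = 1 := Pi.single_eq_same a 1

/-- A form of codegree one is determined by its wedge products with the `dy^a`. -/
lemma eq_zero_of_wedgeOne_dy (σ : Form (k + 1) k) (h : ∀ a, wedgeOne (dy a) σ = 0) : σ = 0 := by
  refine Module.Basis.ext_alternating (Pi.basisFun ℝ (Fin (k + 1))) fun I _ => ?_
  obtain ⟨a, ha⟩ : ∃ a, ∀ i, I i ≠ a := by
    by_contra! hI
    simpa using Fintype.card_le_of_surjective I hI
  have h0 := congrArg (fun τ : Form (k + 1) (k + 1) =>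
    τ (Fin.cons (ee a) fun i => ee (I i))) (h a)
  simp only [wedgeOne_apply, Fin.sum_univ_succ, dy_apply, Fin.cons_zero, Fin.cons_succ,
    Fin.removeNth_zero, Fin.tail_cons, AlternatingMap.zero_apply] at h0
  have hz : ∀ i, ee (I i) a = 0 := fun i => Pi.single_eq_of_ne (ha i).symm 1
  simp only [hz, ee_apply_self, zero_mul, mul_zero, Finset.sum_const_zero, add_zero, Fin.val_zero,
    pow_zero, one_mul] at h0
  simpa [ee] using h0

/-- Every form of codegree one is an interior product of the volume form. -/
lemma exists_curryLeft_vol (τ : Form (k + 1) k) : ∃ x, τ = (vol (k + 1)).curryLeft x := by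
  refine ⟨fun a => wedgeOne (dy a) τ (Pi.basisFun ℝ (Fin (k + 1))), ?_⟩
  rw [← sub_eq_zero]
  refine eq_zero_of_wedgeOne_dy _ fun a => ?_
  rw [map_sub, wedgeOne_curryLeft, sub_eq_zero, dy_apply]
  exact AlternatingMap.eq_smul_basis_det _ _

end WedgeOneForm

section Contraction

variable {n : ℕ}

/-- `mcontract u ω w` evaluates `ω` on a tuple containing the entries of `w`. -/
lemma exists_mcontract_apply {k q : ℕ} (u : Fin k → Vn n) (w : Fin q → Vn n) :
    ∃ x : Fin (q + k) → Vn n, (∀ ω : Form n (q + k), mcontract u ω w = ω x) ∧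
      ∀ j, w j ∈ Set.range x := by
  induction k with
  | zero => exact ⟨w, fun _ => rfl, fun j => ⟨j, rfl⟩⟩
  | succ k ih =>
    obtain ⟨x, hx, hw⟩ := ih fun j => u j.succ
    refine ⟨Fin.cons (u 0) x, fun ω => hx _, fun j => ?_⟩
    obtain ⟨i, hi⟩ := hw j
    exact ⟨i.succ, hi⟩

lemma contract_apply {k q : ℕ} (β : Form n k) (ω : Form n (q + k)) (w : Fin q → Vn n) :
    contract β ω w = ((Nat.factorial k : ℕ) : ℝ)⁻¹ * ∑ I : Fin k → Fin n,
      β (fun j => ee (I j)) * mcontract (fun j => ee (I j)) ω w := by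
  have : IsZeroApply (Form n q) (Fin q → Vn n) ℝ := ⟨fun _ => rfl⟩
  have : IsAddApply (Form n q) (Fin q → Vn n) ℝ := ⟨fun _ _ _ => rfl⟩
  rw [contract, AlternatingMap.smul_apply, sum_apply]
  rfl

lemma contract_add {k q : ℕ} (β : Form n k) (ω ω' : Form n (q + k)) :
    contract β (ω + ω') = contract β ω + contract β ω' := by
  ext w
  rw [AlternatingMap.add_apply, contract_apply, contract_apply, contract_apply, ← mul_add,
    ← Finset.sum_add_distrib]
  refine congrArg _ (Finset.sum_congr rfl fun I _ => ?_)
  obtain ⟨x, hx, -⟩ := exists_mcontract_apply (fun j => ee (I j)) w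
  simp only [hx, AlternatingMap.add_apply, mul_add]

/-- `ι_β τ ∧ τ = 0` for a form `τ` of codegree one. -/
lemma wedgeOne_contract_self {m : ℕ} (β : Form (m + 2) m) (τ : Form (m + 2) (m + 1)) :
    wedgeOne (contract β (Form.castDeg (Nat.add_comm m 1) τ)) τ = 0 := by
  obtain ⟨y, rfl⟩ := exists_curryLeft_vol τ
  rw [wedgeOne_curryLeft]
  convert zero_smul ℝ _
  rw [contract_apply, Finset.sum_eq_zero, mul_zero]
  intro I _
  obtain ⟨x, hx, hy⟩ := exists_mcontract_apply (q := 1) (fun j => ee (I j)) fun _ => y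
  obtain ⟨i, hi⟩ := hy 0
  rw [hx]
  convert mul_zero _
  refine (vol (m + 2)).map_eq_zero_of_eq (i := 0)
    (j := (finCongr (Nat.add_comm m 1)).symm i |>.succ) _ ?_ (Fin.succ_ne_zero _).symm
  simpa using hi.symm

/-- `τ, τ' ↦ ι_β τ ∧ τ'` is antisymmetric on forms of codegree one. -/
lemma wedgeOne_contract_antisymm {m : ℕ} (β : Form (m + 2) m) (τ τ' : Form (m + 2) (m + 1)) :
    wedgeOne (contract β (Form.castDeg (Nat.add_comm m 1) τ)) τ' +
      wedgeOne (contract β (Form.castDeg (Nat.add_comm m 1) τ')) τ = 0 := by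
  have h := wedgeOne_contract_self β (τ + τ')
  have hc : Form.castDeg (Nat.add_comm m 1) (τ + τ') =
    Form.castDeg (Nat.add_comm m 1) τ + Form.castDeg (Nat.add_comm m 1) τ' := rfl
  rw [hc, contract_add, map_add wedgeOne, LinearMap.add_apply, map_add, map_add,
    wedgeOne_contract_self, wedgeOne_contract_self] at h
  simpa using h

end Contraction

/-- `ρ(r)` is a derivation of the pairing of `1`-forms with forms of codegree one, and acts as
`-tr r` on top-degree forms. -/
lemma wedgeOne_rho_add {m : ℕ} (r : Module.End ℝ (Vn (m + 2))) (η : Form (m + 2) 1)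
    (τ : Form (m + 2) (m + 1)) :
    wedgeOne (rho r η) τ + wedgeOne η (rho r τ) =
      -(LinearMap.trace ℝ (Vn (m + 2)) r • wedgeOne η τ) := by
  have htr : LinearMap.trace ℝ (Vn (m + 2)) r = ∑ a, ∑ b, r (ee b) a * (ee a : Vn (m + 2)) b := by
    rw [LinearMap.trace_eq_matrix_trace ℝ (Pi.basisFun ℝ (Fin (m + 2)))]
    simp [Matrix.trace, ee, Pi.single_apply]
  have hη : rho r η = -∑ a, ∑ b, (r (ee b) a * η fun _ => ee a) • dy b := by
    simp only [rho, neg_inj]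
    refine Finset.sum_congr rfl fun a _ => Finset.sum_congr rfl fun b _ => ?_
    rw [castDeg_wedge, mul_smul]
    congr 1
    ext v
    have hv : (fun _ => ee a) = Matrix.vecCons (ee a) ((0 : Fin 1).removeNth v) := by
      ext i : 1
      rw [Subsingleton.elim i 0]
      rfl
    rw [wedgeOne_apply, hv]
    simp [mul_comm, dy_apply]
  have hterm : ∀ a b, wedgeOne η (wedgeOne (dy b) (τ.curryLeft (ee a))) =
      (ee a : Vn (m + 2)) b • wedgeOne η τ - (η fun _ => ee a) • wedgeOne (dy b) τ := by
    intro a b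
    have h := wedgeOne_curryLeft (dy b) (wedgeOne η τ) (ee a)
    rw [curryLeft_wedgeOne, map_sub, map_smul, dy_apply] at h
    rw [wedgeOne_anticomm, ← h]
    abel
  rw [hη, htr]
  simp only [rho, castDeg_wedge, map_neg, map_sum, map_smul, hterm, LinearMap.neg_apply,
    LinearMap.sum_apply, LinearMap.smul_apply, Finset.sum_smul, smul_sub, smul_smul,
    Finset.sum_sub_distrib]
  abel

/-- For `n ≥ 2` (written `n = m + 2`), `r ∈ End(ℝ^n)`, `β ∈ Λ^{n-2}ℝ^n`,
`b ∈ Λ^{n-2}(ℝ^n)^*`, the operator `R` with scaling parameter `l = tr r / 2` is `B`-skew: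
`B(RY, Y') + B(Y, RY') = 0` for all `Y, Y' ∈ W`. -/
theorem Rop_skew_adjoint (m : ℕ) (r : Module.End ℝ (Vn (m + 2)))
    (β : Form (m + 2) m) (b : Form (m + 2) m) :
    ∀ Y Y' : Wsp (m + 1), Bf (Rop r β b Y) Y' + Bf Y (Rop r β b Y') = 0 := by
  rintro ⟨η, τ⟩ ⟨η', τ'⟩
  have hB : ∀ (Y Y' : Wsp (m + 1)), Bf Y Y' = wedgeOne Y.1 Y'.2 + wedgeOne Y'.1 Y.2 :=
    fun _ _ => rfl
  have h₁ := wedgeOne_rho_add r η τ'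
  have h₂ := wedgeOne_rho_add r η' τ
  have h₃ := wedgeOne_contract_antisymm β τ τ'
  have h₄ := wedgeOne_anticomm η η' (sform b)
  simp only [hB, Rop, castDeg_wedge, map_add, map_smul, LinearMap.add_apply,
    LinearMap.smul_apply]
  linear_combination (norm := module) h₁ + h₂ + h₃ + h₄

end
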